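/- If H is an all-to-all spin Hamiltonian with locality k ≥ 2, then the language L_U of its trivial time evolution is not a context-free language. -/

import Mathlib

/-- The finite alphabet of the language: Σ_q ∪ [p] ∪ auxiliary symbols. -/
inductive Symb (q p : ℕ) : Type where
  | spin (s : Fin q)      -- a spin symbol from Σ_q
  | ham (α : Fin p)       -- a local-Hamiltonian label from [p]
  | lhd                   -- ◁
  | rhd                   -- ▷
  | sq                    -- □
  | dia                   -- ◇
  | tri                   -- ▲
  | blank                 -- ␣
  | comp                  -- ∘
  | bullet                -- •
  deriving DecidableEq, Fintype

/-- A local interaction of an all-to-all Hamiltonian: a label and `k` integer addresses. -/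
abbrev AInt (k p : ℕ) := Fin p × (Fin k → ℤ)

/-- A configuration `(s_1, J_1, …, s_n, J_n)` of an all-to-all spin Hamiltonian, where
each `J_j` is a list of local interactions. -/
abbrev AConfig (q k p : ℕ) := List (Fin q × List (AInt k p))

/-- A valid address tuple `(0, a_1, …, a_{k−1})` with `0 < a_1 < ⋯ < a_{k−1} ≤ n − j`
at (0-based) site `j` of a system of `n` spins. -/
def isAddrTuple {k : ℕ} (n j : ℕ) (A : Fin k → ℤ) : Prop :=
  (∀ l : Fin k, (l : ℕ) = 0 → A l = 0) ∧ StrictMono A ∧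
    ∀ l : Fin k, A l ≤ (n : ℤ) - ((j : ℤ) + 1)

/-- Strict lexicographic order on address tuples. -/
def lexLt {k : ℕ} (A B : Fin k → ℤ) : Prop :=
  ∃ l : Fin k, (∀ m < l, A m = B m) ∧ A l < B l

/-- `J ∈ 𝓙_{n,j}`: the address tuples of `J` are exactly the valid address tuples at
site `j`, listed in (strictly increasing) lexicographic order; the labels are arbitrary. -/
def validJ {k p : ℕ} (n j : ℕ) (J : List (AInt k p)) : Prop :=
  (J.map Prod.snd).Pairwise lexLt ∧
    ∀ A : Fin k → ℤ, A ∈ J.map Prod.snd ↔ isAddrTuple n j A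

/-- The domain `𝒟_all` of an all-to-all spin Hamiltonian. -/
def DomainAll (q k p : ℕ) : Set (AConfig q k p) :=
  {x | x ≠ [] ∧ ∀ j : Fin x.length, validJ x.length (j : ℕ) (x.get j).2}

/-- The spin at integer address `l` relative to (0-based) position `j` (▲ if outside). -/
def spinAtA {q k p : ℕ} (x : AConfig q k p) (j : ℕ) (l : ℤ) : Option (Fin q) :=
  if 0 ≤ (j : ℤ) + l then (x[((j : ℤ) + l).toNat]?).map Prod.fst else none

/-- `H(s_1,J_1,…,s_n,J_n) = Σ_j Σ_{(α,A) ∈ J_j} h_α((s_{j+l})_{l ∈ A})`. -/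
def energyA {q k p : ℕ} (h : Fin p → (Fin k → Option (Fin q)) → ℤ)
    (x : AConfig q k p) : ℤ :=
  ∑ j : Fin x.length,
    ((x.get j).2.map fun IA => h IA.1 fun l => spinAtA x (j : ℕ) (IA.2 l)).sum

/-- The unary encoding `u : ℤ → {◇,□}*`. -/
def unary {q p : ℕ} (z : ℤ) : List (Symb q p) :=
  if 0 ≤ z then List.replicate z.toNat Symb.dia else List.replicate (-z).toNat Symb.sq

/-- `γ(α, (a_1,…,a_k)) = α ◁ u(a_1) ␣ ⋯ ␣ u(a_k) ▷`. -/
def encIntA {q k p : ℕ} (I : AInt k p) : List (Symb q p) :=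
  [Symb.ham I.1, Symb.lhd] ++
    List.intercalate [Symb.blank] (List.ofFn fun l => unary (I.2 l)) ++ [Symb.rhd]

/-- `e(s_1,J_1,…,s_n,J_n) = s_1 γ(J_1) ⋯ s_n γ(J_n)`, where `γ(I_1,…,I_m) = γ(I_1)⋯γ(I_m)`. -/
def encConfigA {q k p : ℕ} (x : AConfig q k p) : List (Symb q p) :=
  (x.map fun sJ => Symb.spin sJ.1 :: (sJ.2.map encIntA).flatten).flatten

/-- The language of the trivial time evolution, `L_U = { e(x) ∘ e(x) • : x ∈ 𝒟_all }`. -/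
def langUA {q k p : ℕ} (D : Set (AConfig q k p)) : Language (Symb q p) :=
  {w | ∃ x ∈ D, w = encConfigA x ++ [Symb.comp] ++ encConfigA x ++ [Symb.bullet]}

namespace ContextFreeGrammar

variable {T : Type*} {g : ContextFreeGrammar T}

/-- `g.YieldLength R s n`: the string `s` derives a word of length `n` by a derivation
that only rewrites nonterminals in `R`. -/
inductive YieldLength (g : ContextFreeGrammar T) (R : Finset g.NT) :
    List (Symbol T g.NT) → ℕ → Prop
  | nil : YieldLength g R [] 0
  | terminal (t : T) {s : List (Symbol T g.NT)} {n : ℕ} (hs : YieldLength g R s n) :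
      YieldLength g R (Symbol.terminal t :: s) (n + 1)
  | nonterminal {r : ContextFreeRule T g.NT} (hr : r ∈ g.rules) (hR : r.input ∈ R)
      {s : List (Symbol T g.NT)} {m n : ℕ} (hm : YieldLength g R r.output m)
      (hs : YieldLength g R s n) :
      YieldLength g R (Symbol.nonterminal r.input :: s) (m + n)

namespace YieldLength

variable {R R' : Finset g.NT} {s t : List (Symbol T g.NT)} {m n : ℕ}

lemma mono (hRR : R ⊆ R') (h : g.YieldLength R s n) : g.YieldLength R' s n := by
  induction h with
  | nil => exact nil
  | terminal t _ ih => exact terminal t ih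
  | nonterminal hr hR _ _ ih₁ ih₂ => exact nonterminal hr (hRR hR) ih₁ ih₂

lemma append (hs : g.YieldLength R s m) (ht : g.YieldLength R t n) :
    g.YieldLength R (s ++ t) (m + n) := by
  induction hs with
  | nil => simpa using ht
  | terminal t _ ih =>
    rw [Nat.add_right_comm]
    exact terminal t ih
  | nonterminal hr hR hm _ _ ih =>
    rw [Nat.add_assoc]
    exact nonterminal hr hR hm ih

lemma exists_of_append (h : g.YieldLength R (s ++ t) n) :
    ∃ a b, n = a + b ∧ g.YieldLength R s a ∧ g.YieldLength R t b := by
  induction s generalizing n with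
  | nil => exact ⟨0, n, by simp, nil, h⟩
  | cons x s ih =>
    cases h with
    | terminal t hs =>
      obtain ⟨a, b, rfl, ha, hb⟩ := ih hs
      exact ⟨a + 1, b, by omega, terminal t ha, hb⟩
    | nonterminal hr hR hm hs =>
      obtain ⟨a, b, rfl, ha, hb⟩ := ih hs
      exact ⟨_, b, (Nat.add_assoc _ _ _).symm, nonterminal hr hR hm ha, hb⟩

lemma exists_derives (h : g.YieldLength R s n) :
    ∃ w : List T, w.length = n ∧ g.Derives s (w.map Symbol.terminal) := by
  induction h with
  | nil => exact ⟨[], rfl, Derives.refl _⟩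
  | terminal t _ ih =>
    obtain ⟨w, rfl, hw⟩ := ih
    exact ⟨t :: w, rfl, hw.append_left [Symbol.terminal t]⟩
  | @nonterminal r hr _ s _ _ _ _ ih₁ ih₂ =>
    obtain ⟨w₁, rfl, hw₁⟩ := ih₁
    obtain ⟨w₂, rfl, hw₂⟩ := ih₂
    refine ⟨w₁ ++ w₂, by simp, ?_⟩
    rw [List.map_append]
    exact (Produces.trans_derives ⟨r, hr, .head s⟩ (hw₁.append_right s)).trans
      (hw₂.append_left _)

end YieldLength

/-- The nonterminals that some rule rewrites. -/
noncomputable def inputs (g : ContextFreeGrammar T) : Finset g.NT := by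
  classical exact g.rules.image ContextFreeRule.input

lemma input_mem_inputs {r : ContextFreeRule T g.NT} (hr : r ∈ g.rules) : r.input ∈ g.inputs := by
  classical exact Finset.mem_image_of_mem _ hr

lemma yieldLength_terminals (R : Finset g.NT) (w : List T) :
    g.YieldLength R (w.map Symbol.terminal) w.length := by
  induction w with
  | nil => exact .nil
  | cons t w ih => exact .terminal t ih

lemma Derives.yieldLength {s : List (Symbol T g.NT)} {w : List T}
    (h : g.Derives s (w.map Symbol.terminal)) : g.YieldLength g.inputs s w.length := by
  induction h using Relation.ReflTransGen.head_induction_on with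
  | refl => exact yieldLength_terminals _ w
  | head hp _ ih =>
    obtain ⟨r, hr, hrw⟩ := hp
    obtain ⟨u, v, rfl, rfl⟩ := hrw.exists_parts
    obtain ⟨a, c, hac, ha, hc⟩ := ih.exists_of_append
    obtain ⟨a, b, rfl, ha, hb⟩ := ha.exists_of_append
    rw [hac]
    refine (ha.append ?_).append hc
    simpa using YieldLength.nonterminal hr (input_mem_inputs hr) hb .nil

/-- The lengths of the words derived from `s` contain an infinite arithmetic progression. -/
def Pumps (g : ContextFreeGrammar T) (s : List (Symbol T g.NT)) : Prop :=
  ∃ a d, 0 < d ∧ ∀ i, g.YieldLength g.inputs s (a + d * i)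

/-- If `s` yields the length `n`, then either it does so without rewriting `A`, or an innermost
occurrence of `A` in the derivation exhibits `s` as a context of length `c` around `A`. -/
lemma YieldLength.erase_or [DecidableEq g.NT] {R : Finset g.NT} (hR : R ⊆ g.inputs) (A : g.NT)
    {s : List (Symbol T g.NT)} {n : ℕ} (h : g.YieldLength R s n) :
    g.YieldLength (R.erase A) s n ∨
      ∃ c m, n = c + m ∧
        (∀ l, g.YieldLength g.inputs [.nonterminal A] l → g.YieldLength g.inputs s (c + l)) ∧
        ∃ r ∈ g.rules, r.input = A ∧ g.YieldLength (R.erase A) r.output m := by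
  induction h with
  | nil => exact .inl .nil
  | terminal t _ ih =>
    obtain ih | ⟨c, m, rfl, hc, hr⟩ := ih
    · exact .inl (.terminal t ih)
    · refine .inr ⟨c + 1, m, by omega, fun l hl => ?_, hr⟩
      rw [Nat.add_right_comm]
      exact .terminal t (hc l hl)
  | @nonterminal r hr hrR s a b ha hb ih₁ ih₂ =>
    obtain ih₁ | ⟨c, m, rfl, hc, hr'⟩ := ih₁
    · by_cases hA : r.input = A
      · refine .inr ⟨b, a, Nat.add_comm _ _, fun l hl => ?_, r, hr, hA, ih₁⟩
        rw [Nat.add_comm, hA]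
        exact hl.append (hb.mono hR)
      · obtain ih₂ | ⟨c, m, rfl, hc, hr'⟩ := ih₂
        · exact .inl (.nonterminal hr (Finset.mem_erase.2 ⟨hA, hrR⟩) ih₁ ih₂)
        · refine .inr ⟨a + c, m, by omega, fun l hl => ?_, hr'⟩
          rw [Nat.add_assoc]
          exact .nonterminal hr (hR hrR) (ha.mono hR) (hc l hl)
    · refine .inr ⟨c + b, m, by omega, fun l hl => ?_, hr'⟩
      rw [Nat.add_right_comm]
      exact .nonterminal hr (hR hrR) (hc l hl) (hb.mono hR)

lemma YieldLength.le_mul_or_pumps {R : Finset g.NT} (hR : R ⊆ g.inputs) {K : ℕ} (hK : 1 ≤ K)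
    (hb : ∀ A n, g.YieldLength R [.nonterminal A] n → n ≤ K ∨ g.Pumps [.nonterminal A])
    {s : List (Symbol T g.NT)} {n : ℕ} (h : g.YieldLength R s n) :
    n ≤ s.length * K ∨ g.Pumps s := by
  induction s generalizing n with
  | nil =>
    cases h
    exact .inl (Nat.zero_le _)
  | cons x s ih =>
    obtain ⟨a, b, rfl, ha, hs⟩ := YieldLength.exists_of_append (s := [x]) h
    have hx : a ≤ K ∨ g.Pumps [x] := by
      cases x with
      | terminal t =>
        cases ha with
        | terminal _ h₀ =>
          cases h₀
          exact .inl hK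
      | nonterminal A => exact hb A a ha
    obtain hx | ⟨c, d, hd, hx⟩ := hx
    · obtain ih | ⟨c, d, hd, ih⟩ := ih hs
      · left
        rw [List.length_cons, Nat.succ_mul]
        omega
      · refine .inr ⟨a + c, d, hd, fun i => ?_⟩
        rw [Nat.add_assoc]
        exact (ha.mono hR).append (ih i)
    · refine .inr ⟨c + b, d, hd, fun i => ?_⟩
      rw [Nat.add_right_comm]
      exact (hx i).append (hs.mono hR)

lemma YieldLength.exists_bound_or_pumps (g : ContextFreeGrammar T) (N : ℕ) :
    ∃ K, 1 ≤ K ∧ ∀ R ⊆ g.inputs, R.card ≤ N → ∀ A n,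
      g.YieldLength R [.nonterminal A] n → n ≤ K ∨ g.Pumps [.nonterminal A] := by
  classical
  induction N with
  | zero =>
    refine ⟨1, le_rfl, fun R _ hcard A n h => ?_⟩
    cases h with
    | nonterminal hr hA _ _ => simp_all
  | succ N ih =>
    obtain ⟨K, hK, ih⟩ := ih
    refine ⟨(g.rules.sup (fun r => r.output.length) + 1) * K,
      Nat.mul_pos (Nat.succ_pos _) hK, fun R hR hcard A n h => ?_⟩
    have hAR : A ∈ R := by
      cases h with
      | nonterminal _ hA _ _ => exact hA
    obtain h' | ⟨c, m, rfl, hc, r, hr, rfl, hm⟩ := h.erase_or hR A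
    · cases h' with
      | nonterminal _ hA _ _ => simp at hA
    obtain rfl | hpos := Nat.eq_zero_or_pos c
    · have hRe := (Finset.erase_subset r.input R).trans hR
      have hcard' : (R.erase r.input).card ≤ N := by
        rw [Finset.card_erase_of_mem hAR]
        omega
      obtain hle | ⟨a, d, hd, hp⟩ := hm.le_mul_or_pumps hRe hK (ih _ hRe hcard')
      · left
        have hsup : r.output.length ≤ g.rules.sup (fun r => r.output.length) :=
          Finset.le_sup (f := fun r : ContextFreeRule T g.NT => r.output.length) hr
        rw [Nat.zero_add]
        exact hle.trans (Nat.mul_le_mul_right K (by omega))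
      · exact .inr ⟨a, d, hd, fun i => by
          simpa using YieldLength.nonterminal hr (hR hAR) (hp i) .nil⟩
    · refine .inr ⟨c + m, c, hpos, fun i => ?_⟩
      induction i with
      | zero => exact h.mono hR
      | succ i ih =>
        have := hc _ ih
        rwa [show c + (c + m + c * i) = c + m + c * (i + 1) by ring] at this

end ContextFreeGrammar

/-- The lengths of the words of an infinite context-free language contain an infinite arithmetic
progression. -/
theorem Language.IsContextFree.exists_length_eq_add_mul {T : Type*} {L : Language T}
    (hL : L.IsContextFree) (hinf : ∀ N, ∃ w ∈ L, N < w.length) :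
    ∃ a d, 0 < d ∧ ∀ i, ∃ w ∈ L, w.length = a + d * i := by
  obtain ⟨g, rfl⟩ := hL
  obtain ⟨K, -, hK⟩ := ContextFreeGrammar.YieldLength.exists_bound_or_pumps g g.inputs.card
  obtain ⟨w, hw, hKw⟩ := hinf K
  obtain hle | ⟨a, d, hd, hp⟩ := hK _ subset_rfl le_rfl _ _ (ContextFreeGrammar.Derives.yieldLength
    ((g.mem_language_iff w).1 hw))
  · omega
  · refine ⟨a, d, hd, fun i => ?_⟩
    obtain ⟨w, hw, hder⟩ := (hp i).exists_derives
    exact ⟨w, (g.mem_language_iff w).2 hder, hw⟩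

lemma lexLt_irrefl {k : ℕ} (A : Fin k → ℤ) : ¬ lexLt A A :=
  fun ⟨_, _, h⟩ => lt_irrefl _ h

lemma isAddrTuple.mem_Icc {k n j : ℕ} {A : Fin k → ℤ} (hA : isAddrTuple n j A) :
    A ∈ Set.Icc (fun _ => (0 : ℤ)) (fun _ => (n : ℤ)) := by
  refine ⟨fun l => ?_, fun l => ?_⟩
  · have h0 := hA.1 ⟨0, l.pos⟩ rfl
    have h1 := hA.2.1.monotone (show (⟨0, l.pos⟩ : Fin k) ≤ l from Nat.zero_le _)
    simpa [h0] using h1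
  · have := hA.2.2 l
    show A l ≤ n
    omega

lemma exists_validJ {k p : ℕ} (hp : 0 < p) (n j : ℕ) : ∃ J : List (AInt k p), validJ n j J := by
  have hfin : {A : Lex (Fin k → ℤ) | isAddrTuple n j (ofLex A)}.Finite :=
    (Set.finite_Icc (fun _ : Fin k => (0 : ℤ)) (fun _ => (n : ℤ))).subset
      fun A hA => isAddrTuple.mem_Icc hA
  refine ⟨hfin.toFinset.sort.map fun A => (⟨0, hp⟩, ofLex A), ?_, fun A => ?_⟩
  · rw [List.map_map, List.pairwise_map]
    exact (Finset.sortedLT_sort hfin.toFinset).pairwise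
  · simp only [List.map_map, List.mem_map, Finset.mem_sort, Set.Finite.mem_toFinset]
    exact ⟨by rintro ⟨B, hB, rfl⟩; exact hB, fun hA => ⟨toLex A, hA, rfl⟩⟩

lemma exists_mem_domainAll {q k p : ℕ} (hq : 0 < q) (hp : 0 < p) {n : ℕ} (hn : 0 < n) :
    ∃ x ∈ DomainAll q k p, x.length = n := by
  choose J hJ using fun j : ℕ => exists_validJ (k := k) hp n j
  refine ⟨List.ofFn fun j : Fin n => (⟨0, hq⟩, J j), ⟨?_, fun j => ?_⟩, by simp⟩
  · simpa using hn.ne'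
  · simpa using hJ j

lemma length_unary {q p : ℕ} (z : ℤ) : (unary z : List (Symb q p)).length = z.natAbs := by
  unfold unary
  split_ifs <;> simp <;> omega

lemma List.length_le_length_intercalate {α : Type*} (s : List α) {l : List α} {L : List (List α)}
    (hl : l ∈ L) : l.length ≤ (s.intercalate L).length := by
  induction L with
  | nil => simp at hl
  | cons a L ih =>
    cases L with
    | nil => simp_all [List.intercalate]
    | cons b L =>
      have hcons : (s.intercalate (a :: b :: L)).length =
          a.length + (s.length + (s.intercalate (b :: L)).length) := by
        simp [List.intercalate]
      rw [hcons]
      obtain rfl | hl := List.mem_cons.1 hl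
      · omega
      · have := ih hl
        omega

lemma natAbs_le_length_encIntA {q k p : ℕ} (I : AInt k p) (l : Fin k) :
    (I.2 l).natAbs ≤ (encIntA (q := q) I).length := by
  have := List.length_le_length_intercalate [Symb.blank]
    (List.mem_ofFn.2 ⟨l, rfl⟩ : (unary (I.2 l) : List (Symb q p)) ∈ List.ofFn fun l => unary (I.2 l))
  rw [length_unary] at this
  simp only [encIntA, List.length_append]
  omega

lemma length_encIntA_eq {q k p : ℕ} {I I' : AInt k p} (h : I.2 = I'.2) :
    (encIntA (q := q) I).length = (encIntA (q := q) I').length := by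
  simp [encIntA, h]

lemma validJ.length_encIntA_flatten_eq {q k p n j : ℕ} (hp : 0 < p) {J J' : List (AInt k p)}
    (hJ : validJ n j J) (hJ' : validJ n j J') :
    (J.map (encIntA (q := q))).flatten.length = (J'.map (encIntA (q := q))).flatten.length := by
  have key : ∀ J : List (AInt k p), (J.map (encIntA (q := q))).flatten.length =
      ((J.map Prod.snd).map fun A => (encIntA (q := q) ((⟨0, hp⟩, A) : AInt k p)).length).sum := by
    intro J
    rw [List.length_flatten, List.map_map, List.map_map]
    exact congrArg List.sum (List.map_congr_left fun I _ => length_encIntA_eq rfl)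
  have nodup : ∀ J : List (AInt k p), validJ n j J → (J.map Prod.snd).Nodup := fun J h =>
    h.1.imp fun {A B} hAB => by
      rintro rfl
      exact lexLt_irrefl A hAB
  rw [key, key]
  refine (List.Perm.map _ ?_).sum_eq
  exact (List.perm_ext_iff_of_nodup (nodup J hJ) (nodup J' hJ')).2 fun A =>
    (hJ.2 A).trans (hJ'.2 A).symm

lemma length_encConfigA {q k p : ℕ} (x : AConfig q k p) :
    (encConfigA x).length =
      (x.map fun sJ => (sJ.2.map (encIntA (q := q))).flatten.length + 1).sum := by
  rw [encConfigA, List.length_flatten, List.map_map]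
  exact congrArg List.sum (List.map_congr_left fun _ _ => rfl)

lemma length_encConfigA_eq {q k p : ℕ} (hp : 0 < p) {x x' : AConfig q k p}
    (hx : x ∈ DomainAll q k p) (hx' : x' ∈ DomainAll q k p) (h : x.length = x'.length) :
    (encConfigA x).length = (encConfigA x').length := by
  rw [length_encConfigA, length_encConfigA]
  congr 1
  refine List.ext_getElem (by simpa using h) fun j hj hj' => ?_
  rw [List.length_map] at hj hj'
  have h₁ : validJ x.length j x[j].2 := hx.2 ⟨j, hj⟩
  have h₂ : validJ x.length j x'[j].2 := h ▸ hx'.2 ⟨j, hj'⟩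
  simpa using h₁.length_encIntA_flatten_eq (q := q) hp h₂

lemma length_le_length_encConfigA {q k p : ℕ} (x : AConfig q k p) :
    x.length ≤ (encConfigA x).length := by
  rw [length_encConfigA]
  induction x with
  | nil => simp
  | cons a x ih =>
    simp only [List.map_cons, List.sum_cons, List.length_cons]
    omega

lemma isAddrTuple_shift {k n j D : ℕ} (h : j + k + D ≤ n) :
    isAddrTuple n j fun l : Fin k => if (l : ℕ) = 0 then 0 else (D + l : ℤ) := by
  refine ⟨fun l hl => if_pos hl, fun l m hlm => ?_, fun l => ?_⟩
  · have : (l : ℕ) < m := hlm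
    dsimp only
    split_ifs <;> omega
  · have := l.isLt
    dsimp only
    split_ifs <;> omega

lemma validJ.le_length_flatten {q k p n j D : ℕ} (hk : 2 ≤ k) {J : List (AInt k p)}
    (hJ : validJ n j J) (h : j + k + D ≤ n) :
    D ≤ (J.map (encIntA (q := q))).flatten.length := by
  obtain ⟨I, hI, hIA⟩ := List.mem_map.1 ((hJ.2 _).2 (isAddrTuple_shift h))
  have h₁ := natAbs_le_length_encIntA (q := q) I ⟨1, hk⟩
  rw [hIA] at h₁
  have h₂ : (encIntA (q := q) I).length ≤ (J.map (encIntA (q := q))).flatten.length :=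
    (List.sublist_flatten_of_mem (List.mem_map_of_mem hI)).length_le
  simp only [one_ne_zero, if_false] at h₁
  omega

/-- The length of the encoding grows faster than every linear function of the system size. -/
lemma mul_le_length_encConfigA {q k p : ℕ} (hk : 2 ≤ k) {x : AConfig q k p}
    (hx : x ∈ DomainAll q k p) (D : ℕ) :
    (x.length - (k + D)) * D ≤ (encConfigA x).length := by
  set f : Fin q × List (AInt k p) → ℕ :=
    fun sJ => (sJ.2.map (encIntA (q := q))).flatten.length + 1 with hf
  have hsplit : (encConfigA x).length =
      ((x.take (x.length - (k + D))).map f).sum + ((x.drop (x.length - (k + D))).map f).sum := by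
    rw [length_encConfigA, ← List.sum_append, ← List.map_append, List.take_append_drop]
  have hle := List.card_nsmul_le_sum ((x.take (x.length - (k + D))).map f) D fun y hy => by
    obtain ⟨sJ, hs, rfl⟩ := List.mem_map.1 hy
    obtain ⟨j, hj, rfl⟩ := List.mem_iff_getElem.1 hs
    rw [List.length_take] at hj
    have hj' : j < x.length := by omega
    have := (hx.2 ⟨j, hj'⟩).le_length_flatten (q := q) (D := D) hk
      (show j + k + D ≤ x.length by omega)
    simp only [hf, List.getElem_take]
    exact Nat.le_succ_of_le this
  simp only [List.length_map, List.length_take, smul_eq_mul] at hle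
  rw [Nat.min_eq_left (by omega)] at hle
  omega

lemma Function.Injective.exists_le_of_nat {f : ℕ → ℕ} (hf : f.Injective) (M : ℕ) :
    ∃ i ≤ M, M ≤ f i := by
  by_contra! h
  obtain ⟨i, -, j, -, hij, hfij⟩ := Finset.exists_ne_map_eq_of_card_lt_of_maps_to
    (s := Finset.range (M + 1)) (t := Finset.range M) (f := f) (by simp)
    (fun i hi => by simpa using h i (by simpa [Nat.lt_succ_iff] using hi))
  exact hij (hf hfij)


/-- If `H` is an all-to-all spin Hamiltonian with locality `k ≥ 2`,
then the language `L_U` of its trivial time evolution is not context-free. -/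
theorem langU_allToAll_not_contextFree {q k p : ℕ} (hq : 0 < q) (hk : 2 ≤ k) (hp : 0 < p)
    (h : Fin p → (Fin k → Option (Fin q)) → ℤ) :
    ¬ (langUA (DomainAll q k p)).IsContextFree := by
  intro hL
  obtain ⟨a, d, hd, hprog⟩ := hL.exists_length_eq_add_mul fun N => by
    obtain ⟨x, hx, hxN⟩ := exists_mem_domainAll (k := k) hq hp N.succ_pos
    refine ⟨_, ⟨x, hx, rfl⟩, ?_⟩
    have := length_le_length_encConfigA x
    simp only [List.length_append, List.length_singleton]
    omega
  have hconf : ∀ i, ∃ x ∈ DomainAll q k p, 2 * (encConfigA x).length + 2 = a + d * i := by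
    intro i
    obtain ⟨w, ⟨x, hx, rfl⟩, hw⟩ := hprog i
    refine ⟨x, hx, ?_⟩
    simp only [List.length_append, List.length_singleton] at hw
    omega
  choose x hx hlen using hconf
  have hinj : Function.Injective fun i => (x i).length := fun i j hij => by
    have h₁ := length_encConfigA_eq hp (hx i) (hx j) hij
    have h₂ : a + d * i = a + d * j := by rw [← hlen i, ← hlen j, h₁]
    exact Nat.eq_of_mul_eq_mul_left hd (Nat.add_left_cancel h₂)
  obtain ⟨i, hi, hMi⟩ := hinj.exists_le_of_nat (a + 2 * (k + d) + 1)
  have hlow := mul_le_length_encConfigA hk (hx i) d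
  have hi' := hlen i
  obtain ⟨m, hm⟩ := Nat.exists_eq_add_of_le (show k + d ≤ (x i).length by omega)
  rw [hm, Nat.add_sub_cancel_left] at hlow
  have h₁ : a + i ≤ 2 * m := by omega
  have h₂ := Nat.mul_le_mul_right d h₁
  have h₃ := Nat.le_mul_of_pos_right a hd
  nlinarith
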